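/- Let A and B be real symmetric n × n matrices, with A positive definite with smallest eigenvalue λ > 0. If ‖A − B‖_F ≤ η < λ (Frobenius norm), then B is positive definite and |Tr(A⁻¹) − Tr(B⁻¹)| ≤ nη/(λ − η)². -/

import Mathlib

open Matrix

/-- A Hermitian matrix whose eigenvalues are at least `c` has Rayleigh quotients at least `c`. -/
lemma Matrix.IsHermitian.mul_dotProduct_self_le {ι : Type*} [Fintype ι] [DecidableEq ι]
    {A : Matrix ι ι ℝ} (hA : A.IsHermitian) {c : ℝ} (hc : ∀ i, c ≤ hA.eigenvalues i)
    (x : ι → ℝ) : c * (x ⬝ᵥ x) ≤ x ⬝ᵥ (A *ᵥ x) := by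
  have hdiag : (diagonal fun i => hA.eigenvalues i - c).PosSemidef :=
    PosSemidef.diagonal fun i => sub_nonneg.2 (hc i)
  have hpsd := hdiag.mul_mul_conjTranspose_same (hA.eigenvectorUnitary : Matrix ι ι ℝ)
  have hunit : (hA.eigenvectorUnitary : Matrix ι ι ℝ) *
      (hA.eigenvectorUnitary : Matrix ι ι ℝ)ᴴ = 1 :=
    Unitary.coe_mul_star_self hA.eigenvectorUnitary
  have hspec : A = (hA.eigenvectorUnitary : Matrix ι ι ℝ) * diagonal hA.eigenvalues *
      (hA.eigenvectorUnitary : Matrix ι ι ℝ)ᴴ := by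
    conv_lhs => rw [hA.spectral_theorem, Unitary.conjStarAlgAut_apply]
    rfl
  have hsplit : (diagonal fun i => hA.eigenvalues i - c) =
      diagonal hA.eigenvalues - c • (1 : Matrix ι ι ℝ) := by
    rw [smul_one_eq_diagonal, diagonal_sub]
  rw [hsplit, mul_sub, sub_mul, ← hspec, Matrix.mul_smul, mul_one, Matrix.smul_mul, hunit] at hpsd
  have h := hpsd.dotProduct_mulVec_nonneg x
  simpa [sub_mulVec, smul_mulVec, dotProduct_sub, dotProduct_smul] using h

/-- The Cauchy–Schwarz inequality for the dot product of real vectors. -/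
lemma abs_dotProduct_le_sqrt_mul_sqrt {ι : Type*} [Fintype ι] (x y : ι → ℝ) :
    |x ⬝ᵥ y| ≤ √(x ⬝ᵥ x) * √(y ⬝ᵥ y) := by
  have hx : 0 ≤ x ⬝ᵥ x := Finset.sum_nonneg fun i _ => mul_self_nonneg (x i)
  rw [← Real.sqrt_mul hx]
  apply Real.abs_le_sqrt
  simpa [dotProduct, sq] using Finset.sum_mul_sq_le_sq_mul_sq Finset.univ x y

/-- The Euclidean operator norm of a real matrix is at most its Frobenius norm. -/
lemma sqrt_mulVec_dotProduct_self_le {ι κ : Type*} [Fintype ι] [Fintype κ]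
    (E : Matrix ι κ ℝ) (y : κ → ℝ) :
    √((E *ᵥ y) ⬝ᵥ (E *ᵥ y)) ≤ √(∑ i, ∑ j, E i j ^ 2) * √(y ⬝ᵥ y) := by
  have hE : 0 ≤ ∑ i, ∑ j, E i j ^ 2 := by positivity
  rw [← Real.sqrt_mul hE]
  apply Real.sqrt_le_sqrt
  rw [Finset.sum_mul]
  refine Finset.sum_le_sum fun i _ => ?_
  simpa [dotProduct, mulVec, sq] using Finset.sum_mul_sq_le_sq_mul_sq Finset.univ (E i) y

/-- A bilinear form is bounded by the Frobenius norm of its matrix. -/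
lemma abs_dotProduct_mulVec_le {ι κ : Type*} [Fintype ι] [Fintype κ]
    (E : Matrix ι κ ℝ) (x : ι → ℝ) (y : κ → ℝ) :
    |x ⬝ᵥ (E *ᵥ y)| ≤ √(∑ i, ∑ j, E i j ^ 2) * (√(x ⬝ᵥ x) * √(y ⬝ᵥ y)) :=
  calc |x ⬝ᵥ (E *ᵥ y)| ≤ √(x ⬝ᵥ x) * √((E *ᵥ y) ⬝ᵥ (E *ᵥ y)) :=
        abs_dotProduct_le_sqrt_mul_sqrt _ _
    _ ≤ √(x ⬝ᵥ x) * (√(∑ i, ∑ j, E i j ^ 2) * √(y ⬝ᵥ y)) := by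
        gcongr
        exact sqrt_mulVec_dotProduct_self_le E y
    _ = _ := by ring

/-- If `M` is bounded below by `c`, its right inverse is bounded by `1 / c`. -/
lemma sqrt_dotProduct_self_le_div {ι : Type*} [Fintype ι] {M : Matrix ι ι ℝ} {c : ℝ}
    (hc : 0 < c) (hM : ∀ x, c * (x ⬝ᵥ x) ≤ x ⬝ᵥ (M *ᵥ x)) (y : ι → ℝ) :
    √(y ⬝ᵥ y) ≤ √((M *ᵥ y) ⬝ᵥ (M *ᵥ y)) / c := by
  have hy : 0 ≤ y ⬝ᵥ y := Finset.sum_nonneg fun i _ => mul_self_nonneg (y i)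
  have h := (hM y).trans ((le_abs_self _).trans (abs_dotProduct_le_sqrt_mul_sqrt y (M *ᵥ y)))
  rw [le_div_iff₀ hc]
  rcases (Real.sqrt_nonneg (y ⬝ᵥ y)).eq_or_lt with h0 | hpos
  · rw [← h0, zero_mul]
    exact Real.sqrt_nonneg _
  · refine le_of_mul_le_mul_left ?_ hpos
    nlinarith [Real.mul_self_sqrt hy]

/-- Trace-of-inverse perturbation estimate of Appendix C: if `A`, `B` are real
symmetric `n × n` matrices, `A` is positive definite with smallest eigenvalue
`λ > 0`, and `‖A − B‖_F ≤ η < λ`, then `B` is positive definite and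
`|Tr(A⁻¹) − Tr(B⁻¹)| ≤ nη/(λ − η)²`. -/
theorem stmt_13 (n : ℕ) (A B : Matrix (Fin n) (Fin n) ℝ)
    (hA : A.IsHermitian) (hB : B.IsHermitian) (hApd : A.PosDef)
    (lam : ℝ) (hlam : lam = ⨅ i, hA.eigenvalues i) (hlam_pos : 0 < lam)
    (η : ℝ) (hη : Real.sqrt (∑ i, ∑ j, (A i j - B i j) ^ 2) ≤ η)
    (heta_lam : η < lam) :
    B.PosDef ∧ |(A⁻¹).trace - (B⁻¹).trace| ≤ n * η / (lam - η) ^ 2 := by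
  have hη0 : 0 ≤ η := (Real.sqrt_nonneg _).trans hη
  have hgap : 0 < lam - η := sub_pos.2 heta_lam
  have hle (i : Fin n) : lam ≤ hA.eigenvalues i :=
    hlam ▸ ciInf_le (Set.finite_range _).bddBelow i
  have hAlow := hA.mul_dotProduct_self_le hle
  have hE (x y : Fin n → ℝ) :
      |x ⬝ᵥ ((A - B) *ᵥ y)| ≤ η * (√(x ⬝ᵥ x) * √(y ⬝ᵥ y)) :=
    (abs_dotProduct_mulVec_le (A - B) x y).trans (by gcongr; exact hη)
  have hBlow (x : Fin n → ℝ) : (lam - η) * (x ⬝ᵥ x) ≤ x ⬝ᵥ (B *ᵥ x) := by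
    have hxx : 0 ≤ x ⬝ᵥ x := Finset.sum_nonneg fun i _ => mul_self_nonneg (x i)
    have h := (le_abs_self _).trans (hE x x)
    rw [Real.mul_self_sqrt hxx,
      sub_mulVec, dotProduct_sub] at h
    linarith [hAlow x]
  have hBpd : B.PosDef := by
    refine PosDef.of_dotProduct_mulVec_pos hB fun x hx => ?_
    have hxx : 0 < x ⬝ᵥ x := by simpa using dotProduct_star_self_pos_iff.2 hx
    simpa using (mul_pos hgap hxx).trans_le (hBlow x)
  refine ⟨hBpd, ?_⟩
  have hAdet : IsUnit A.det := hApd.det_pos.ne'.isUnit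
  have hBdet : IsUnit B.det := hBpd.det_pos.ne'.isUnit
  have hresolvent : A⁻¹ - B⁻¹ = -(A⁻¹ * ((A - B) * B⁻¹)) := by
    rw [sub_mul, mul_nonsing_inv B hBdet, mul_sub, ← mul_assoc, nonsing_inv_mul A hAdet]
    simp
  have hcol {M : Matrix (Fin n) (Fin n) ℝ} {c : ℝ} (hc : 0 < c) (hdet : IsUnit M.det)
      (hM : ∀ x, c * (x ⬝ᵥ x) ≤ x ⬝ᵥ (M *ᵥ x)) (i : Fin n) :
      √(M⁻¹.col i ⬝ᵥ M⁻¹.col i) ≤ 1 / c := by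
    have h := sqrt_dotProduct_self_le_div hc hM (M⁻¹.col i)
    have hone : M *ᵥ M⁻¹.col i = Pi.single i 1 := by
      rw [← mulVec_single_one, mulVec_mulVec, mul_nonsing_inv M hdet, one_mulVec]
    simpa [hone] using h
  have hentry (i : Fin n) : |(A⁻¹ - B⁻¹) i i| ≤ η / (lam - η) ^ 2 := by
    have hdot : (A⁻¹ * ((A - B) * B⁻¹)) i i = A⁻¹.col i ⬝ᵥ ((A - B) *ᵥ B⁻¹.col i) := by
      have hrow : A⁻¹.col i = A⁻¹ i :=
        funext fun j => by simpa using hA.inv.apply i j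
      rw [hrow]
      rfl
    rw [hresolvent, Matrix.neg_apply, abs_neg, hdot]
    calc _ ≤ η * (√(A⁻¹.col i ⬝ᵥ A⁻¹.col i) * √(B⁻¹.col i ⬝ᵥ B⁻¹.col i)) := hE _ _
      _ ≤ η * (1 / (lam - η) * (1 / (lam - η))) := by
          gcongr
          · exact (hcol hlam_pos hAdet hAlow i).trans
              (one_div_le_one_div_of_le hgap (by linarith))
          · exact hcol hgap hBdet hBlow i
      _ = η / (lam - η) ^ 2 := by field_simp
  rw [← trace_sub]
  calc |(A⁻¹ - B⁻¹).trace| ≤ ∑ i, |(A⁻¹ - B⁻¹) i i| := Finset.abs_sum_le_sum_abs _ _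
    _ ≤ ∑ _i : Fin n, η / (lam - η) ^ 2 := Finset.sum_le_sum fun i _ => hentry i
    _ = n * η / (lam - η) ^ 2 := by simp [mul_div_assoc]
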